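/- Let M be an n × n integer matrix with det(M − I) = 0 (where I is the identity matrix). Then there exists a matrix P ∈ GLₙ(ℤ) (an integer matrix invertible over ℤ) such that the first column of P⁻¹MP is the first standard basis vector e₁ = (1, 0, …, 0)ᵀ. -/

import Mathlib

/-- If the kernel of an endomorphism of a finite free module over a principal ideal domain is
nontrivial, then it contains a member of some basis, at any prescribed index. -/
theorem exists_basis_apply_eq_zero {R V W ι : Type*} [CommRing R] [IsDomain R]
    [IsPrincipalIdealRing R] [AddCommGroup V] [Module R V] [AddCommGroup W] [Module R W]
    [Module.IsTorsionFree R W] [Finite ι] (b : Module.Basis ι R V)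
    (φ : V →ₗ[R] W) (hφ : LinearMap.ker φ ≠ ⊥) (i : ι) :
    ∃ c : Module.Basis ι R V, φ (c i) = 0 := by
  classical
  obtain ⟨k, s⟩ := Submodule.smithNormalForm b (LinearMap.ker φ)
  have hk : 0 < k := by
    rw [Nat.pos_iff_ne_zero]
    rintro rfl
    have := s.bN.repr.toEquiv.subsingleton
    exact hφ (Submodule.subsingleton_iff_eq_bot.mp this)
  let j : Fin k := ⟨0, hk⟩
  have ha : s.a j ≠ 0 := by
    intro ha
    refine s.bN.ne_zero j (Subtype.ext ?_)
    rw [s.snf j, ha, zero_smul, ZeroMemClass.coe_zero]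
  have hker : s.a j • φ (s.bM (s.f j)) = 0 := by
    rw [← map_smul, ← s.snf j]
    exact (s.bN j).2
  refine ⟨s.bM.reindex (Equiv.swap (s.f j) i), ?_⟩
  simpa [ha] using hker

/-- if `M` is an `n × n` integer matrix with `det(M − I) = 0`, then there is
a matrix `P ∈ GLₙ(ℤ)` such that the first column of `P⁻¹MP` is the first standard basis
vector `e₁`. -/
theorem exists_conjugate_first_column_e1 {n : ℕ} (M : Matrix (Fin n) (Fin n) ℤ)
    (hdet : (M - 1).det = 0) :
    ∃ P : Matrix.GeneralLinearGroup (Fin n) ℤ,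
      ∀ i j : Fin n, (j : ℕ) = 0 →
        ((↑(P⁻¹) : Matrix (Fin n) (Fin n) ℤ) * M * (↑P : Matrix (Fin n) (Fin n) ℤ)) i j =
          if (i : ℕ) = 0 then 1 else 0 := by
  obtain _ | n := n
  · exact ⟨1, fun i => i.elim0⟩
  obtain ⟨v, hv, hMv⟩ := Matrix.exists_mulVec_eq_zero_iff.mpr hdet
  have hker : LinearMap.ker (Matrix.mulVecLin (M - 1)) ≠ ⊥ := fun h =>
    hv (LinearMap.ker_eq_bot'.mp h v hMv)
  obtain ⟨c, hc⟩ := exists_basis_apply_eq_zero (Pi.basisFun ℤ (Fin (n + 1))) _ hker 0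
  let P : Matrix.GeneralLinearGroup (Fin (n + 1)) ℤ :=
    ⟨(Pi.basisFun ℤ _).toMatrix c, c.toMatrix (Pi.basisFun ℤ _),
      Module.Basis.toMatrix_mul_toMatrix_flip _ _, Module.Basis.toMatrix_mul_toMatrix_flip _ _⟩
  have hcol : (P : Matrix (Fin (n + 1)) (Fin (n + 1)) ℤ).col 0 = c 0 := by
    ext i
    simp [P, Module.Basis.toMatrix_apply]
  have hfix : M.mulVec (c 0) = c 0 := by
    simpa [Matrix.sub_mulVec, sub_eq_zero] using hc
  refine ⟨P, fun i j hj => ?_⟩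
  obtain rfl : j = 0 := Fin.ext hj
  have key : ((↑(P⁻¹) : Matrix (Fin (n + 1)) (Fin (n + 1)) ℤ) * M *
      (↑P : Matrix (Fin (n + 1)) (Fin (n + 1)) ℤ)).col 0 =
      (1 : Matrix (Fin (n + 1)) (Fin (n + 1)) ℤ).col 0 := by
    rw [← P.inv_mul, ← Matrix.mulVec_single_one, ← Matrix.mulVec_single_one,
      ← Matrix.mulVec_mulVec, ← Matrix.mulVec_mulVec, ← Matrix.mulVec_mulVec,
      Matrix.mulVec_single_one, hcol, hfix]
  have := congrFun key i
  rw [Matrix.col_apply, Matrix.col_apply, Matrix.one_apply] at this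
  simpa only [Fin.ext_iff, Fin.val_zero] using this
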